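/- arXiv:1811.09754 — 2 statements merged into one kernel-verified Lean document; each statement's English description precedes it below -/
import Mathlib

section
/- Completeness of the basis in the weighted space: let ξ : ℝ → ℝ be continuously differentiable and 2π-periodic with ξ(0) = 0 and ∫_{-π}^{π} ξ'(θ)²/sin²(θ/2) dθ < ∞. If ⟨ξ, ẽ_k^{(o)}⟩_g = 0 for every integer k ≥ 1 and ⟨ξ, ẽ_l^{(e)}⟩_g = 0 for every integer l ≥ 0, then ξ is identically zero. -/
open Real MeasureTheory intervalIntegral

/-- The odd basis functions `ẽ_k^{(o)}(θ) = sin((k+1)θ)/(k+1) − sin(kθ)/k`. -/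
noncomputable def eOdd (k : ℕ) : ℝ → ℝ :=
  fun θ => Real.sin (((k : ℝ) + 1) * θ) / ((k : ℝ) + 1) - Real.sin ((k : ℝ) * θ) / (k : ℝ)

/-- The even basis functions: `ẽ_0^{(e)}(θ) = cos θ − 1` and, for `l ≥ 1`,
`ẽ_l^{(e)}(θ) = (cos((l+1)θ) − 1)/(l+1) − (cos(lθ) − 1)/l`. -/
noncomputable def eEven (l : ℕ) : ℝ → ℝ :=
  fun θ =>
    if l = 0 then Real.cos θ - 1
    else (Real.cos (((l : ℝ) + 1) * θ) - 1) / ((l : ℝ) + 1) -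
      (Real.cos ((l : ℝ) * θ) - 1) / (l : ℝ)

lemma deriv_eOdd {k : ℕ} (hk : 1 ≤ k) (θ : ℝ) :
    deriv (eOdd k) θ = -2 * Real.sin (((k : ℝ) + 1 / 2) * θ) * Real.sin (θ / 2) := by
  have hk0 : (k : ℝ) ≠ 0 := by positivity
  have hk1 : (k : ℝ) + 1 ≠ 0 := by positivity
  have hlin (c : ℝ) : HasDerivAt (fun x : ℝ => c * x) c θ := by
    simpa using (hasDerivAt_id θ).const_mul c
  have hd : HasDerivAt (eOdd k)
      (Real.cos (((k : ℝ) + 1) * θ) * ((k : ℝ) + 1) / ((k : ℝ) + 1)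
        - Real.cos ((k : ℝ) * θ) * k / k) θ :=
    ((hlin _).sin.div_const _).sub ((hlin _).sin.div_const _)
  rw [hd.deriv, mul_div_cancel_right₀ _ hk0, mul_div_cancel_right₀ _ hk1, Real.cos_sub_cos]
  ring_nf

lemma deriv_eEven (l : ℕ) (θ : ℝ) :
    deriv (eEven l) θ = -2 * Real.cos (((l : ℝ) + 1 / 2) * θ) * Real.sin (θ / 2) := by
  rcases Nat.eq_zero_or_pos l with rfl | hl
  · have hE : eEven 0 = fun θ => Real.cos θ - 1 := by
      ext θ; simp [eEven]
    have hs : Real.sin θ = 2 * Real.sin (θ / 2) * Real.cos (θ / 2) := by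
      rw [← Real.sin_two_mul]; ring_nf
    rw [hE, ((Real.hasDerivAt_cos θ).sub_const 1).deriv, hs]
    push_cast
    ring_nf
  · have hl0 : (l : ℝ) ≠ 0 := by positivity
    have hl1 : (l : ℝ) + 1 ≠ 0 := by positivity
    have hlin (c : ℝ) : HasDerivAt (fun x : ℝ => c * x) c θ := by
      simpa using (hasDerivAt_id θ).const_mul c
    have hE : eEven l = fun θ => (Real.cos (((l : ℝ) + 1) * θ) - 1) / ((l : ℝ) + 1) -
        (Real.cos ((l : ℝ) * θ) - 1) / (l : ℝ) := by
      ext θ; simp [eEven, hl.ne']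
    have hd : HasDerivAt (eEven l)
        (-Real.sin (((l : ℝ) + 1) * θ) * ((l : ℝ) + 1) / ((l : ℝ) + 1)
          - -Real.sin ((l : ℝ) * θ) * l / l) θ := by
      rw [hE]
      exact (((hlin _).cos.sub_const 1).div_const _).sub
        (((hlin _).cos.sub_const 1).div_const _)
    have hs := Real.sin_sub_sin ((l : ℝ) * θ) (((l : ℝ) + 1) * θ)
    rw [hd.deriv, mul_div_cancel_right₀ _ hl0, mul_div_cancel_right₀ _ hl1,
      sub_neg_eq_add, neg_add_eq_sub, hs,
      show ((l : ℝ) * θ - ((l : ℝ) + 1) * θ) / 2 = -(θ / 2) by ring, Real.sin_neg]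
    ring_nf

/-- A continuous `2π`-periodic function is zero if it is orthogonal to the trigonometric
system. -/
lemma eq_zero_of_integral_mul_cos_sin_eq_zero {f : ℝ → ℝ} (hf : Continuous f)
    (hper : Function.Periodic f (2 * π))
    (hcos : ∀ n : ℕ, ∫ θ in (-π)..π, f θ * Real.cos (n * θ) = 0)
    (hsin : ∀ n : ℕ, ∫ θ in (-π)..π, f θ * Real.sin (n * θ) = 0) (θ : ℝ) : f θ = 0 := by
  have : Fact (0 < 2 * π) := ⟨Real.two_pi_pos⟩
  have hperC : Function.Periodic (fun x => (f x : ℂ)) (2 * π) := fun x => by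
    simp only [hper x]
  let F : C(AddCircle (2 * π), ℂ) :=
    ⟨hperC.lift, continuous_coinduced_dom.mpr (Complex.continuous_ofReal.comp hf)⟩
  have hF (x : ℝ) : F (x : AddCircle (2 * π)) = f x := hperC.lift_coe x
  have hcosZ (n : ℤ) : ∫ θ in (-π)..π, f θ * Real.cos (n * θ) = 0 := by
    obtain ⟨m, rfl | rfl⟩ := n.eq_nat_or_neg
    · exact_mod_cast hcos m
    · simpa using hcos m
  have hsinZ (n : ℤ) : ∫ θ in (-π)..π, f θ * Real.sin (n * θ) = 0 := by
    obtain ⟨m, rfl | rfl⟩ := n.eq_nat_or_neg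
    · exact_mod_cast hsin m
    · simpa using hsin m
  have hcoeff (n : ℤ) : fourierCoeff F n = 0 := by
    have hexp (x : ℝ) : fourier (-n) (x : AddCircle (2 * π)) • F (x : AddCircle (2 * π)) =
        ((f x * Real.cos (n * x) : ℝ) : ℂ) - ((f x * Real.sin (n * x) : ℝ) : ℂ) * Complex.I := by
      have hpi : (π : ℂ) ≠ 0 := by exact_mod_cast Real.pi_ne_zero
      have harg : 2 * π * Complex.I * ((-n : ℤ) : ℂ) * x / ((2 * π : ℝ) : ℂ)
          = ((-(n * x) : ℝ) : ℂ) * Complex.I := by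
        push_cast
        field_simp
      rw [fourier_coe_apply, hF, harg, Complex.exp_mul_I, ← Complex.ofReal_cos,
        ← Complex.ofReal_sin, Real.cos_neg, Real.sin_neg, smul_eq_mul]
      push_cast
      ring
    rw [fourierCoeff_eq_intervalIntegral F n (-π), show -π + 2 * π = π by ring]
    simp_rw [hexp]
    rw [intervalIntegral.integral_sub
        (Continuous.intervalIntegrable (by fun_prop) _ _)
        (Continuous.intervalIntegrable (by fun_prop) _ _),
      intervalIntegral.integral_mul_const, intervalIntegral.integral_ofReal,
      intervalIntegral.integral_ofReal, hcosZ, hsinZ]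
    simp
  have hzero : (fun n : ℤ => fourierCoeff F n) = fun _ => 0 := funext hcoeff
  have hsum := has_pointwise_sum_fourier_series_of_summable (f := F)
    (by rw [show fourierCoeff F = fun _ => 0 from hzero]; exact summable_zero)
    (θ : AddCircle (2 * π))
  simp only [hcoeff, zero_smul, hF] at hsum
  exact_mod_cast hsum.unique hasSum_zero

/-- Completeness of the basis `{ẽ_k^{(o)}} ∪ {ẽ_l^{(e)}}` in the weighted space: a `C¹`,
`2π`-periodic function `ξ` with `ξ(0) = 0` and finite weighted Dirichlet energy which is
`g`-orthogonal to all basis vectors is identically zero. -/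
theorem basis_complete (ξ : ℝ → ℝ) (hξ : ContDiff ℝ 1 ξ)
    (hper : Function.Periodic ξ (2 * Real.pi)) (h0 : ξ 0 = 0)
    (hfin : IntervalIntegrable (fun θ => (deriv ξ θ) ^ 2 / Real.sin (θ / 2) ^ 2)
      volume (-Real.pi) Real.pi)
    (ho : ∀ k : ℕ, 1 ≤ k →
      (1 / (4 * Real.pi)) *
        ∫ θ in (-Real.pi)..Real.pi,
          deriv ξ θ * deriv (eOdd k) θ / Real.sin (θ / 2) ^ 2 = 0)
    (he : ∀ l : ℕ,
      (1 / (4 * Real.pi)) *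
        ∫ θ in (-Real.pi)..Real.pi,
          deriv ξ θ * deriv (eEven l) θ / Real.sin (θ / 2) ^ 2 = 0) :
    ∀ θ : ℝ, ξ θ = 0 := by
  set f := deriv ξ with hfdef
  have hfc : Continuous f := hξ.continuous_deriv le_rfl
  have hfper : Function.Periodic f (2 * π) := fun x => by
    rw [hfdef, ← deriv_comp_add_const, funext hper]
  have hξd : Differentiable ℝ ξ := hξ.differentiable one_ne_zero
  have hmean : ∫ θ in (-π)..π, f θ = 0 := by
    rw [intervalIntegral.integral_deriv_eq_sub (fun x _ => hξd x)
      (hfc.intervalIntegrable _ _), ← hper (-π), show -π + 2 * π = π by ring, sub_self]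
  set h : ℝ → ℝ := fun θ => f θ / Real.sin (θ / 2) with hh
  have hint : IntervalIntegrable h volume (-π) π := by
    refine (hfin.add (intervalIntegrable_const (c := (1 : ℝ)))).mono_fun ?_ ?_
    · exact (hfc.measurable.div (by fun_prop)).aestronglyMeasurable
    · refine Filter.Eventually.of_forall fun x => ?_
      have hsq : f x ^ 2 / Real.sin (x / 2) ^ 2 = |h x| ^ 2 := by
        rw [sq_abs, hh, div_pow]
      simp only [Real.norm_eq_abs, hsq]
      rw [abs_of_nonneg (by positivity : 0 ≤ |h x| ^ 2 + 1)]
      nlinarith [sq_nonneg (|h x| - 1), abs_nonneg (h x)]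
  have hfh : ∀ᵐ x : ℝ, x ∈ Set.uIoc (-π) π → f x = h x * Real.sin (x / 2) := by
    filter_upwards [Measure.ae_ne volume (0 : ℝ)] with x hx hmem
    rw [Set.uIoc_of_le (by linarith [Real.pi_pos])] at hmem
    have hs : Real.sin (x / 2) ≠ 0 := by
      rw [Ne, Real.sin_eq_zero_iff_of_lt_of_lt (by linarith [hmem.1, Real.pi_pos]) (by
        linarith [hmem.2, Real.pi_pos])]
      simpa using hx
    exact (div_mul_cancel₀ _ hs).symm
  have hweight (x s : ℝ) : f x * (-2 * s * Real.sin (x / 2)) / Real.sin (x / 2) ^ 2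
      = -2 * (h x * s) := by
    by_cases hs : Real.sin (x / 2) = 0
    · simp [hh, hs]
    · simp only [hh]; field_simp
  have hpi : 1 / (4 * π) ≠ 0 := by positivity
  have hsin (k : ℕ) : ∫ θ in (-π)..π, h θ * Real.sin (((k : ℝ) + 1 / 2) * θ) = 0 := by
    rcases Nat.eq_zero_or_pos k with rfl | hk
    · rw [← hmean]
      refine intervalIntegral.integral_congr_ae (hfh.mono fun x hx hmem => ?_)
      rw [hx hmem]
      push_cast
      ring_nf
    · have := (mul_eq_zero.mp (ho k hk)).resolve_left hpi
      simp_rw [deriv_eOdd hk, hweight, intervalIntegral.integral_const_mul] at this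
      linarith
  have hcos (l : ℕ) : ∫ θ in (-π)..π, h θ * Real.cos (((l : ℝ) + 1 / 2) * θ) = 0 := by
    have := (mul_eq_zero.mp (he l)).resolve_left hpi
    simp_rw [deriv_eEven, hweight, intervalIntegral.integral_const_mul] at this
    linarith
  have hintsin (c : ℝ) : IntervalIntegrable (fun θ => h θ * Real.sin (c * θ)) volume (-π) π :=
    hint.mul_continuousOn (by fun_prop)
  have hintcos (c : ℝ) : IntervalIntegrable (fun θ => h θ * Real.cos (c * θ)) volume (-π) π :=
    hint.mul_continuousOn (by fun_prop)
  have hf0 : ∀ θ, f θ = 0 := by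
    refine eq_zero_of_integral_mul_cos_sin_eq_zero hfc hfper (fun n => ?_) fun n => ?_
    · rcases n with _ | m
      · simpa using hmean
      · have : ∫ θ in (-π)..π, f θ * Real.cos ((m + 1 : ℕ) * θ) =
            ∫ θ in (-π)..π, (1 / 2) * (h θ * Real.sin ((((m + 1 : ℕ) : ℝ) + 1 / 2) * θ)
              - h θ * Real.sin (((m : ℝ) + 1 / 2) * θ)) := by
          refine intervalIntegral.integral_congr_ae (hfh.mono fun x hx hmem => ?_)
          rw [hx hmem, ← mul_sub, Real.sin_sub_sin]
          push_cast
          ring_nf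
        rw [this, intervalIntegral.integral_const_mul,
          intervalIntegral.integral_sub (hintsin _) (hintsin _), hsin, hsin]
        simp
    · rcases n with _ | m
      · simp
      · have : ∫ θ in (-π)..π, f θ * Real.sin ((m + 1 : ℕ) * θ) =
            ∫ θ in (-π)..π, (-1 / 2) * (h θ * Real.cos ((((m + 1 : ℕ) : ℝ) + 1 / 2) * θ)
              - h θ * Real.cos (((m : ℝ) + 1 / 2) * θ)) := by
          refine intervalIntegral.integral_congr_ae (hfh.mono fun x hx hmem => ?_)
          rw [hx hmem, ← mul_sub, Real.cos_sub_cos]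
          push_cast
          ring_nf
        rw [this, intervalIntegral.integral_const_mul,
          intervalIntegral.integral_sub (hintcos _) (hintcos _), hcos, hcos]
        simp
  intro θ
  rw [is_const_of_deriv_eq_zero hξd hf0 θ 0, h0]
end

section
/- Exponential decay for the linearized system (Proposition 3.1/3.2, ODE form): let d_k = (k−1)²(k+1)/(2k²) for k ≥ 1. Suppose a_k : [0, ∞) → ℝ (k ≥ 1) are differentiable functions, a_0 ≡ 0, satisfying a_k'(t) = −d_k a_{k−1}(t) − (d_{k+1} − d_k) a_k(t) + d_{k+1} a_{k+1}(t) for all k ≥ 1 and t ≥ 0. Assume that for every t ≥ 0 the series E(t) = Σ_{k≥1} a_k(t)² converges, that Σ_{k≥1} d_{k+1} |a_k(t)| |a_{k+1}(t)| converges, and that E is differentiable with E'(t) = Σ_{k≥1} 2 a_k(t) a_k'(t) (the series converging absolutely). Then E(t) ≤ e^{−(3/4)t} E(0) for all t ≥ 0; equivalently, the ℓ²-norm of (a_k(t)) is at most e^{−(3/8)t} times the ℓ²-norm of (a_k(0)). -/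
open Real

/-- The tridiagonal coefficients `d_k = (k−1)²(k+1)/(2k²)` (so `d_1 = 0`). -/
noncomputable def dCoef (k : ℕ) : ℝ :=
  ((k : ℝ) - 1) ^ 2 * ((k : ℝ) + 1) / (2 * (k : ℝ) ^ 2)

theorem dCoef_nonneg (k : ℕ) : 0 ≤ dCoef k := by
  unfold dCoef
  positivity

theorem le_dCoef_succ_sub (k : ℕ) : 3 / 8 ≤ dCoef (k + 2) - dCoef (k + 1) := by
  have hx : (0 : ℝ) ≤ k := k.cast_nonneg
  have hgap : dCoef (k + 2) - dCoef (k + 1) - 3 / 8 =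
      k * ((k : ℝ) ^ 3 + 6 * k ^ 2 + 17 * k + 16) / (8 * (k + 1) ^ 2 * (k + 2) ^ 2) := by
    unfold dCoef
    push_cast
    field_simp
    ring
  have : (0 : ℝ) ≤
      k * ((k : ℝ) ^ 3 + 6 * k ^ 2 + 17 * k + 16) / (8 * (k + 1) ^ 2 * (k + 2) ^ 2) := by
    positivity
  linarith

/-- The off-diagonal terms telescope, and the diagonal gap bounds the energy dissipation. -/
theorem tsum_energy_le (x : ℕ → ℝ) (e : ℝ) (hx0 : x 0 = 0)
    (hx : HasSum (fun k : ℕ => x (k + 1) ^ 2) e)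
    (habs : Summable (fun k : ℕ => dCoef (k + 2) * |x (k + 1)| * |x (k + 2)|))
    (hs : Summable (fun k : ℕ => 2 * x (k + 1) *
      (-(dCoef (k + 1)) * x k - (dCoef (k + 2) - dCoef (k + 1)) * x (k + 1) +
        dCoef (k + 2) * x (k + 2)))) :
    ∑' k : ℕ, 2 * x (k + 1) *
      (-(dCoef (k + 1)) * x k - (dCoef (k + 2) - dCoef (k + 1)) * x (k + 1) +
        dCoef (k + 2) * x (k + 2)) ≤ -(3 / 4) * e := by
  set b : ℕ → ℝ := fun k => dCoef (k + 1) * x k * x (k + 1) with hb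
  have hb1 : Summable (fun k => b (k + 1)) := by
    refine Summable.of_abs (habs.congr fun k => ?_)
    simp only [hb, abs_mul, abs_of_nonneg (dCoef_nonneg _)]
  have hbs : HasSum b (∑' k, b (k + 1)) := by
    have h := (hasSum_nat_add_iff (f := b) 1).1 hb1.hasSum
    simpa [hb, hx0] using h
  have htel := ((hb1.hasSum.sub hbs).mul_left 2).add (hx.mul_left (-(3 / 4)))
  rw [sub_self, mul_zero, zero_add] at htel
  refine hasSum_le (fun k => ?_) hs.hasSum htel
  have hgap := mul_le_mul_of_nonneg_right (le_dCoef_succ_sub k) (sq_nonneg (x (k + 1)))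
  simp only [hb]
  linarith

theorem le_exp_mul_of_hasDerivAt_le {E E' : ℝ → ℝ} {c : ℝ}
    (hE : ∀ t, 0 ≤ t → HasDerivAt E (E' t) t) (hle : ∀ t, 0 ≤ t → E' t ≤ -c * E t)
    {t : ℝ} (ht : 0 ≤ t) : E t ≤ Real.exp (-c * t) * E 0 := by
  have hF : ∀ s, 0 ≤ s → HasDerivAt (fun s => Real.exp (c * s) * E s)
      (Real.exp (c * s) * c * E s + Real.exp (c * s) * E' s) s := fun s hs => by
    have h : HasDerivAt (fun s => Real.exp (c * s)) (Real.exp (c * s) * c) s := by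
      simpa using ((hasDerivAt_id s).const_mul c).exp
    exact h.mul (hE s hs)
  have hanti : AntitoneOn (fun s => Real.exp (c * s) * E s) (Set.Ici 0) := by
    refine antitoneOn_of_hasDerivWithinAt_nonpos (convex_Ici 0)
      (fun s hs => (hF s hs).continuousAt.continuousWithinAt)
      (fun s hs => (hF s (interior_subset hs)).hasDerivWithinAt) fun s hs => ?_
    have h := mul_le_mul_of_nonneg_left (hle s (interior_subset hs)) (Real.exp_pos (c * s)).le
    linarith
  have h : Real.exp (c * t) * E t ≤ E 0 := by
    simpa using hanti Set.self_mem_Ici (Set.mem_Ici.2 ht) ht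
  rw [neg_mul, Real.exp_neg, inv_mul_eq_div, le_div_iff₀ (Real.exp_pos _)]
  linarith

/-- Exponential decay for the linearized system: if `a_k' = −d_k a_{k−1} − (d_{k+1}−d_k) a_k
+ d_{k+1} a_{k+1}` for `k ≥ 1` with `a_0 ≡ 0`, and `E(t) = Σ_{k≥1} a_k(t)²` with the stated
convergence and differentiability hypotheses, then `E(t) ≤ e^{−(3/4)t} E(0)`, i.e. the
`ℓ²`-norm decays like `e^{−(3/8)t}`. -/
theorem linearized_exponential_decay
    (a : ℕ → ℝ → ℝ) (E : ℝ → ℝ)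
    (h0 : ∀ t : ℝ, a 0 t = 0)
    (hode : ∀ k : ℕ, 1 ≤ k → ∀ t : ℝ, 0 ≤ t →
      HasDerivAt (a k)
        (-(dCoef k) * a (k - 1) t - (dCoef (k + 1) - dCoef k) * a k t +
          dCoef (k + 1) * a (k + 1) t) t)
    (hE : ∀ t : ℝ, 0 ≤ t → HasSum (fun k : ℕ => (a (k + 1) t) ^ 2) (E t))
    (habs : ∀ t : ℝ, 0 ≤ t →
      Summable (fun k : ℕ => dCoef (k + 2) * |a (k + 1) t| * |a (k + 2) t|))
    (hE'abs : ∀ t : ℝ, 0 ≤ t →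
      Summable (fun k : ℕ =>
        |2 * a (k + 1) t *
          (-(dCoef (k + 1)) * a k t - (dCoef (k + 2) - dCoef (k + 1)) * a (k + 1) t +
            dCoef (k + 2) * a (k + 2) t)|))
    (hE' : ∀ t : ℝ, 0 ≤ t →
      HasDerivAt E
        (∑' k : ℕ, 2 * a (k + 1) t *
          (-(dCoef (k + 1)) * a k t - (dCoef (k + 2) - dCoef (k + 1)) * a (k + 1) t +
            dCoef (k + 2) * a (k + 2) t)) t) :
    ∀ t : ℝ, 0 ≤ t →
      E t ≤ Real.exp (-(3 / 4) * t) * E 0 ∧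
      Real.sqrt (E t) ≤ Real.exp (-(3 / 8) * t) * Real.sqrt (E 0) := by
  intro t ht
  have hdecay : E t ≤ Real.exp (-(3 / 4) * t) * E 0 :=
    le_exp_mul_of_hasDerivAt_le hE' (fun s hs =>
      tsum_energy_le (fun k => a k s) (E s) (h0 s) (hE s hs) (habs s hs)
        (hE'abs s hs).of_abs) ht
  refine ⟨hdecay, (Real.sqrt_le_sqrt hdecay).trans_eq ?_⟩
  rw [Real.sqrt_mul (Real.exp_pos _).le, ← Real.exp_half]
  ring_nf
end
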